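/- arXiv:2002.10503 — 5 statements merged into one kernel-verified Lean document; each statement's English description precedes it below -/
import Mathlib

section
/- Fix n ≥ 2, a permutation w ∈ S_n, and k ∈ {1,…,n−1}. Then min_k(w) = expat_k(w); that is, the minimum number of occurrences of σ_k among all reduced decompositions of w equals |{w(1),…,w(k)} ∩ {k+1,…,n}|. -/
/-- The simple reflection `σ_i = (i, i+1)`, acting on `ℕ` (1-indexed positions/values). -/
def simpleRefl (i : ℕ) : Equiv.Perm ℕ := Equiv.swap i (i + 1)

/-- `w` is a permutation of `{1, …, n}`: it fixes every point outside `[1, n]`. -/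
def IsPermOf (n : ℕ) (w : Equiv.Perm ℕ) : Prop :=
  ∀ x : ℕ, x ∉ Finset.Icc 1 n → w x = x

/-- The Coxeter length of `w`: its number of inversions on `{1, …, n}`. -/
def len (n : ℕ) (w : Equiv.Perm ℕ) : ℕ :=
  ((Finset.Icc 1 n ×ˢ Finset.Icc 1 n).filter fun p => p.1 < p.2 ∧ w p.2 < w p.1).card

/-- `L` is a word for `w`: a list of indices in `[1, n-1]` whose associated product of
simple reflections (read left to right) is `w`. -/
def IsWord (n : ℕ) (w : Equiv.Perm ℕ) (L : List ℕ) : Prop :=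
  (∀ i ∈ L, 1 ≤ i ∧ i ≤ n - 1) ∧ (L.map simpleRefl).prod = w

/-- `L` is a reduced decomposition of `w`. -/
def IsReducedWord (n : ℕ) (w : Equiv.Perm ℕ) (L : List ℕ) : Prop :=
  IsWord n w L ∧ L.length = len n w

/-- `min_k(w)`: the minimum number of occurrences of `σ_k` in a reduced decomposition of `w`. -/
noncomputable def minOcc (n k : ℕ) (w : Equiv.Perm ℕ) : ℕ :=
  sInf {m | ∃ L : List ℕ, IsReducedWord n w L ∧ L.count k = m}

/-- `max_k(w)`: the maximum number of occurrences of `σ_k` in a reduced decomposition of `w`. -/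
noncomputable def maxOcc (n k : ℕ) (w : Equiv.Perm ℕ) : ℕ :=
  sSup {m | ∃ L : List ℕ, IsReducedWord n w L ∧ L.count k = m}

/-- `expat_k(w) = |{w(1),…,w(k)} ∩ {k+1,…,n}|`. -/
def expat (n k : ℕ) (w : Equiv.Perm ℕ) : ℕ :=
  (((Finset.Icc 1 k).image fun i => w i) ∩ Finset.Icc (k + 1) n).card

/-- A `321`-pattern of `w` in positions `i1 < i2 < i3` (within `[1, n]`). -/
def Is321At (n : ℕ) (w : Equiv.Perm ℕ) (i1 i2 i3 : ℕ) : Prop :=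
  1 ≤ i1 ∧ i1 < i2 ∧ i2 < i3 ∧ i3 ≤ n ∧ w i3 < w i2 ∧ w i2 < w i1

/-- A `3412`-pattern of `w` in positions `i1 < i2 < i3 < i4` (within `[1, n]`). -/
def Is3412At (n : ℕ) (w : Equiv.Perm ℕ) (i1 i2 i3 i4 : ℕ) : Prop :=
  1 ≤ i1 ∧ i1 < i2 ∧ i2 < i3 ∧ i3 < i4 ∧ i4 ≤ n ∧
    w i3 < w i4 ∧ w i4 < w i1 ∧ w i1 < w i2

/-- `p` is a position pair at `k`: `p = (i1, i3)` for a `321`-pattern with `i1 ≤ k < i3`,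
or `p = (i2, i3)` for a `3412`-pattern with `i2 ≤ k < i3`. -/
def IsPosPair (n k : ℕ) (w : Equiv.Perm ℕ) (p : ℕ × ℕ) : Prop :=
  (∃ i2, Is321At n w p.1 i2 p.2 ∧ p.1 ≤ k ∧ k < p.2) ∨
  (∃ i1 i4, Is3412At n w i1 p.1 p.2 i4 ∧ p.1 ≤ k ∧ k < p.2)

/-- `p` is a value pair at `k`: `p = (j3, j1)` for a `321`-pattern with values
`j1 < j2 < j3` and `j1 ≤ k < j3`, or `p = (j4, j1)` for a `3412`-pattern with values
`j1 < j2 < j3 < j4` and `j2 ≤ k < j3`. -/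
def IsValPair (n k : ℕ) (w : Equiv.Perm ℕ) (p : ℕ × ℕ) : Prop :=
  (∃ i1 i2 i3, Is321At n w i1 i2 i3 ∧ w i3 ≤ k ∧ k < w i1 ∧ p = (w i1, w i3)) ∨
  (∃ i1 i2 i3 i4, Is3412At n w i1 i2 i3 i4 ∧ w i4 ≤ k ∧ k < w i1 ∧ p = (w i2, w i3))

/-- `PosPair_k(w)`: the number of distinct position pairs at `k` in `w`. -/
noncomputable def posPairCount (n k : ℕ) (w : Equiv.Perm ℕ) : ℕ :=
  Set.ncard {p : ℕ × ℕ | IsPosPair n k w p}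

/-- `ValPair_k(w)`: the number of distinct value pairs at `k` in `w`. -/
noncomputable def valPairCount (n k : ℕ) (w : Equiv.Perm ℕ) : ℕ :=
  Set.ncard {p : ℕ × ℕ | IsValPair n k w p}

theorem sr_lt {n i x : ℕ} (hi : 1 ≤ i ∧ i ≤ n - 1) (hx : x ∈ Finset.Icc 1 n) :
    simpleRefl i x ∈ Finset.Icc 1 n := by
  simp only [simpleRefl, Equiv.swap_apply_def, Finset.mem_Icc] at *
  split_ifs <;> omega

theorem sr_sr (i x : ℕ) : simpleRefl i (simpleRefl i x) = x := by
  simp [simpleRefl]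

theorem sr_mul (i : ℕ) : simpleRefl i * simpleRefl i = 1 := by
  ext x; simp [sr_sr]

theorem perm_mul {n i : ℕ} {w : Equiv.Perm ℕ} (hi : 1 ≤ i ∧ i ≤ n - 1) (hw : IsPermOf n w) :
    IsPermOf n (w * simpleRefl i) := by
  intro x hx
  have : simpleRefl i x = x := by
    simp only [simpleRefl, Equiv.swap_apply_def, Finset.mem_Icc] at *
    split_ifs <;> omega
  rw [Equiv.Perm.mul_apply, this, hw x hx]

theorem perm_mem {n x : ℕ} {w : Equiv.Perm ℕ} (hw : IsPermOf n w) (hx : x ∈ Finset.Icc 1 n) :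
    w x ∈ Finset.Icc 1 n := by
  by_contra h
  have := w.injective (hw _ h)
  rw [this] at h
  exact h hx

def ex (k : ℕ) (w : Equiv.Perm ℕ) : ℕ := ((Finset.Icc 1 k).filter fun i => k < w i).card

theorem expat_eq {n k : ℕ} {w : Equiv.Perm ℕ} (hw : IsPermOf n w) (hk2 : k ≤ n - 1) :
    expat n k w = ex k w := by
  unfold expat ex
  rw [← Finset.card_image_of_injective ((Finset.Icc 1 k).filter fun i => k < w i) w.injective]
  congr 1
  ext y
  simp only [Finset.mem_inter, Finset.mem_image, Finset.mem_Icc, Finset.mem_filter]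
  constructor
  · rintro ⟨⟨x, hx, rfl⟩, h⟩
    exact ⟨x, ⟨hx, by omega⟩, rfl⟩
  · rintro ⟨x, ⟨hx, h⟩, rfl⟩
    refine ⟨⟨x, hx, rfl⟩, h, ?_⟩
    have := perm_mem hw (x := x) (Finset.mem_Icc.2 (by omega))
    exact (Finset.mem_Icc.1 this).2

theorem ex_ne {k i : ℕ} (w : Equiv.Perm ℕ) (hi : 1 ≤ i) (h : i ≠ k) :
    ex k (w * simpleRefl i) = ex k w := by
  unfold ex
  have key : ∀ x ∈ Finset.Icc 1 k, simpleRefl i x ∈ Finset.Icc 1 k := by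
    intro x hx
    simp only [simpleRefl, Equiv.swap_apply_def, Finset.mem_Icc] at *
    split_ifs <;> omega
  apply Finset.card_nbij' (simpleRefl i) (simpleRefl i)
  · intro x hx
    rw [Finset.mem_coe, Finset.mem_filter] at hx ⊢
    simp only [Equiv.Perm.mul_apply] at hx ⊢
    exact ⟨key x hx.1, hx.2⟩
  · intro x hx
    rw [Finset.mem_coe, Finset.mem_filter] at hx ⊢
    simp only [Equiv.Perm.mul_apply, sr_sr] at hx ⊢
    exact ⟨key x hx.1, hx.2⟩
  · intro x _; exact sr_sr i x
  · intro x _; exact sr_sr i x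

theorem ex_split {k : ℕ} (hk : 1 ≤ k) (w : Equiv.Perm ℕ) :
    ex k w = ((Finset.Icc 1 (k-1)).filter fun i => k < w i).card + if k < w k then 1 else 0 := by
  unfold ex
  have : Finset.Icc 1 k = insert k (Finset.Icc 1 (k-1)) := by
    ext x; simp only [Finset.mem_Icc, Finset.mem_insert]; omega
  rw [this, Finset.filter_insert]
  split_ifs
  · rw [Finset.card_insert_of_notMem]
    simp; omega
  · simp

theorem ex_k {k : ℕ} (hk : 1 ≤ k) (w : Equiv.Perm ℕ) :
    ex k (w * simpleRefl k) =
      ((Finset.Icc 1 (k-1)).filter fun i => k < w i).card + if k < w (k+1) then 1 else 0 := by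
  rw [ex_split hk]
  congr 1
  · congr 1
    apply Finset.filter_congr
    intro x hx
    have : simpleRefl k x = x := by
      simp only [simpleRefl, Equiv.swap_apply_def, Finset.mem_Icc] at *
      split_ifs <;> omega
    rw [Equiv.Perm.mul_apply, this]
  · simp [simpleRefl]

theorem ex_one (k : ℕ) : ex k 1 = 0 := by
  unfold ex
  rw [Finset.card_eq_zero, Finset.filter_eq_empty_iff]
  intro x hx
  rw [Finset.mem_Icc] at hx
  simp only [Equiv.Perm.one_apply]
  omega

theorem lower {n k : ℕ} (hk : 1 ≤ k) (L : List ℕ) (hL : ∀ i ∈ L, 1 ≤ i ∧ i ≤ n - 1) :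
    ex k (L.map simpleRefl).prod ≤ L.count k := by
  induction L using List.reverseRecOn with
  | nil => simp [ex_one]
  | append_singleton L i ih =>
    have ih := ih (fun j hj => hL j (by simp [hj]))
    have hi := hL i (by simp)
    rw [List.map_append, List.prod_append, List.count_append]
    simp only [List.map_cons, List.map_nil, List.prod_cons, List.prod_nil, mul_one]
    by_cases h : i = k
    · subst h
      rw [ex_k hk]
      rw [ex_split hk] at ih
      simp only [List.count_singleton_self]
      split_ifs at * <;> omega
    · rw [ex_ne _ hi.1 h]; omega

theorem len_succ {n i : ℕ} {w : Equiv.Perm ℕ} (hi : 1 ≤ i ∧ i ≤ n - 1) (h : w (i+1) < w i) :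
    len n w = len n (w * simpleRefl i) + 1 := by
  unfold len
  have hm : (i, i+1) ∈ ((Finset.Icc 1 n ×ˢ Finset.Icc 1 n).filter
      fun p => p.1 < p.2 ∧ w p.2 < w p.1) := by
    simp only [Finset.mem_filter, Finset.mem_product, Finset.mem_Icc]
    refine ⟨by omega, by omega, h⟩
  rw [← Finset.card_erase_add_one hm]
  congr 1
  apply Finset.card_nbij' (Prod.map (simpleRefl i) (simpleRefl i))
    (Prod.map (simpleRefl i) (simpleRefl i))
  · rintro ⟨a, b⟩ hab
    rw [Finset.mem_coe, Finset.mem_erase, Finset.mem_filter] at hab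
    rw [Finset.mem_coe, Finset.mem_filter] at ⊢
    simp only [ne_eq, Finset.mem_product, Prod.mk.injEq, Prod.map_apply,
      Equiv.Perm.mul_apply, sr_sr] at hab ⊢
    obtain ⟨hne, ⟨ha, hb⟩, hlt, hw⟩ := hab
    refine ⟨⟨sr_lt hi ha, sr_lt hi hb⟩, ?_, hw⟩
    simp only [simpleRefl, Equiv.swap_apply_def]
    split_ifs <;> omega
  · rintro ⟨a, b⟩ hab
    rw [Finset.mem_coe, Finset.mem_filter] at hab
    rw [Finset.mem_coe, Finset.mem_erase, Finset.mem_filter] at ⊢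
    simp only [ne_eq, Finset.mem_product, Prod.mk.injEq, Prod.map_apply,
      Equiv.Perm.mul_apply] at hab ⊢
    obtain ⟨⟨ha, hb⟩, hlt, hw⟩ := hab
    have hne : ¬ (a = i ∧ b = i + 1) := by
      rintro ⟨rfl, rfl⟩
      simp [simpleRefl] at hw
      omega
    refine ⟨?_, ⟨sr_lt hi ha, sr_lt hi hb⟩, ?_, hw⟩
    all_goals
      simp only [simpleRefl, Equiv.swap_apply_def]
      split_ifs <;> omega
  · rintro ⟨a, b⟩ _; simp [sr_sr]
  · rintro ⟨a, b⟩ _; simp [sr_sr]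

theorem eq_one_of {n : ℕ} {w : Equiv.Perm ℕ} (hw : IsPermOf n w)
    (h : ∀ i, 1 ≤ i → i ≤ n - 1 → w i < w (i+1)) : w = 1 := by
  have hm : StrictMono w := by
    apply strictMono_nat_of_lt_succ
    intro i
    have h0 : ∀ j, j < 1 ∨ n < j → w j = j := fun j hj =>
      hw j (by rw [Finset.mem_Icc]; omega)
    by_cases h1 : 1 ≤ i ∧ i ≤ n - 1
    · exact h i h1.1 h1.2
    · by_cases h2 : i = 0
      · subst h2
        rw [h0 0 (by omega)]
        rcases Nat.eq_zero_or_pos (w (0+1)) with h3 | h3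
        · have := w.injective (h3.trans (h0 0 (by omega)).symm); omega
        · exact h3
      · rw [h0 (i+1) (by omega)]
        by_cases h4 : i = n
        · have := Finset.mem_Icc.1 (perm_mem hw (x := i) (Finset.mem_Icc.2 (by omega)))
          omega
        · rw [h0 i (by omega)]; omega
  ext x
  have h1 := hm.le_apply (x := x)
  have hm' : StrictMono w.symm := by
    intro a b hab
    rw [← hm.lt_iff_lt]; simpa using hab
  have h2 := hm'.le_apply (x := w x)
  simp at h2 ⊢
  omega

theorem incr {w : Equiv.Perm ℕ} {a b : ℕ} (h : ∀ i, a ≤ i → i < b → w i < w (i+1)) :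
    ∀ j, a ≤ j → ∀ d, j + d ≤ b → w j ≤ w (j + d) := by
  intro j hj d
  induction d with
  | zero => simp
  | succ d ih =>
    intro hd
    have := ih (by omega)
    have := h (j + d) (by omega) (by omega)
    rw [← add_assoc]; omega

theorem upper {n k : ℕ} (hk1 : 1 ≤ k) (hk2 : k ≤ n - 1) : ∀ (m : ℕ) (w : Equiv.Perm ℕ),
    IsPermOf n w → len n w = m → ∃ L, IsReducedWord n w L ∧ L.count k = ex k w := by
  intro m
  induction m with
  | zero =>
    intro w hw hl
    have : w = 1 := by
      apply eq_one_of hw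
      intro i h1 h2
      by_contra h
      have h3 : w (i+1) ≠ w i := fun h => by have := w.injective h; omega
      have := len_succ (w := w) ⟨h1, h2⟩ (by omega)
      omega
    subst this
    exact ⟨[], ⟨⟨by simp, by simp⟩, by simp [hl]⟩, by simp [ex_one]⟩
  | succ m ih =>
    intro w hw hl
    have step : ∀ i, 1 ≤ i → i ≤ n - 1 → w (i+1) < w i →
        ex k w = ex k (w * simpleRefl i) + [i].count k →
        ∃ L, IsReducedWord n w L ∧ L.count k = ex k w := by
      intro i h1 h2 hd he
      have hs := len_succ (w := w) ⟨h1, h2⟩ hd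
      obtain ⟨L, ⟨⟨hL1, hL2⟩, hL3⟩, hc⟩ := ih (w * simpleRefl i) (perm_mul ⟨h1, h2⟩ hw) (by omega)
      refine ⟨L ++ [i], ⟨⟨?_, ?_⟩, ?_⟩, ?_⟩
      · intro j hj
        rw [List.mem_append, List.mem_singleton] at hj
        rcases hj with hj | rfl
        · exact hL1 j hj
        · exact ⟨h1, h2⟩
      · simp [hL2, mul_assoc, sr_mul]
      · simp [hL3, hs]
      · rw [List.count_append, hc, he]
    by_cases hex : ∃ i, 1 ≤ i ∧ i ≤ n - 1 ∧ i ≠ k ∧ w (i+1) < w i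
    · obtain ⟨i, h1, h2, h3, h4⟩ := hex
      refine step i h1 h2 h4 ?_
      rw [ex_ne w h1 h3]
      simp [h3]
    · have hasc : ∀ i, 1 ≤ i → i ≤ n - 1 → i ≠ k → w i < w (i+1) := by
        intro i h1 h2 h3
        by_contra h4
        have h5 : w (i+1) ≠ w i := fun h => by have := w.injective h; omega
        exact hex ⟨i, h1, h2, h3, by omega⟩
      by_cases hd : w (k+1) < w k
      · have hA := incr (w := w) (a := 1) (b := k)
          (fun i h1 h2 => hasc i h1 (by omega) (by omega))
        have hB := incr (w := w) (a := k+1) (b := n)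
          (fun i h1 h2 => hasc i (by omega) (by omega) (by omega))
        have hpos : ∀ x, 1 ≤ x → x ≤ n → 1 ≤ w x := fun x h1 h2 =>
          (Finset.mem_Icc.1 (perm_mem hw (Finset.mem_Icc.2 ⟨h1, h2⟩))).1
        have e1 : k < w k := by
          by_contra hc
          have hsub : (Finset.Icc 1 k).image w ⊆ Finset.Icc 1 k := by
            intro y hy
            obtain ⟨x, hx, rfl⟩ := Finset.mem_image.1 hy
            rw [Finset.mem_Icc] at hx ⊢
            have := hA x hx.1 (k - x) (by omega)
            rw [show x + (k - x) = k by omega] at this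
            exact ⟨hpos x hx.1 (by omega), by omega⟩
          have heq := Finset.eq_of_subset_of_card_le hsub
            (by rw [Finset.card_image_of_injective _ w.injective])
          have : w (k+1) ∈ (Finset.Icc 1 k).image w := by
            rw [heq, Finset.mem_Icc]
            exact ⟨hpos _ (by omega) (by omega), by omega⟩
          obtain ⟨x, hx, hxe⟩ := Finset.mem_image.1 this
          have := w.injective hxe
          rw [Finset.mem_Icc] at hx
          omega
        have e2 : w (k+1) ≤ k := by
          by_contra hc
          have hsub : (Finset.Icc (k+1) n).image w ⊆ Finset.Icc (k+1) n := by
            intro y hy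
            obtain ⟨x, hx, rfl⟩ := Finset.mem_image.1 hy
            rw [Finset.mem_Icc] at hx
            have := hB (k+1) le_rfl (x - (k+1)) (by omega)
            rw [show (k+1) + (x - (k+1)) = x by omega] at this
            have := Finset.mem_Icc.1 (perm_mem hw (x := x) (Finset.mem_Icc.2 (by omega)))
            rw [Finset.mem_Icc]
            omega
          have heq := Finset.eq_of_subset_of_card_le hsub
            (by rw [Finset.card_image_of_injective _ w.injective])
          have : w k ∈ (Finset.Icc (k+1) n).image w := by
            rw [heq]
            have := Finset.mem_Icc.1 (perm_mem hw (x := k) (Finset.mem_Icc.2 (by omega)))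
            rw [Finset.mem_Icc]
            omega
          obtain ⟨x, hx, hxe⟩ := Finset.mem_image.1 this
          have := w.injective hxe
          rw [Finset.mem_Icc] at hx
          omega
        refine step k hk1 hk2 hd ?_
        rw [ex_k hk1, ex_split hk1, if_pos e1, if_neg (by omega)]
        simp
      · exfalso
        have h5 : w (k+1) ≠ w k := fun h => by have := w.injective h; omega
        have : w = 1 := by
          apply eq_one_of hw
          intro i h1 h2
          by_cases h : i = k
          · subst h; omega
          · exact hasc i h1 h2 h
        subst this
        have : len n 1 = 0 := by
          unfold len
          rw [Finset.card_eq_zero, Finset.filter_eq_empty_iff]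
          intro x hx
          simp only [Equiv.Perm.one_apply]
          omega
        omega

/-- Theorem: minimal repetition. For `n ≥ 2`, `w ∈ S_n`, and
`k ∈ {1,…,n-1}`, the minimum number of occurrences of `σ_k` among reduced
decompositions of `w` equals `expat_k(w)`. -/
theorem min_occurrences_eq_expat (n : ℕ) (hn : 2 ≤ n) (w : Equiv.Perm ℕ)
    (hw : IsPermOf n w) (k : ℕ) (hk1 : 1 ≤ k) (hk2 : k ≤ n - 1) :
    minOcc n k w = expat n k w := by
  rw [expat_eq hw hk2]
  unfold minOcc
  obtain ⟨L, hL, hc⟩ := upper hk1 hk2 _ w hw rfl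
  apply le_antisymm
  · exact Nat.sInf_le ⟨L, hL, hc⟩
  · obtain ⟨M, hM, hMc⟩ := Nat.sInf_mem
      (s := {m | ∃ L : List ℕ, IsReducedWord n w L ∧ L.count k = m}) ⟨_, L, hL, hc⟩
    rw [← hMc, ← hM.1.2]
    exact lower hk1 M hM.1.1
end

section
/- Fix n ≥ 2, a permutation w ∈ S_n, and k ∈ {1,…,n−1}. Every expression of w as a product of simple reflections (not necessarily reduced) contains at least expat_k(w) occurrences of σ_k. -/
theorem card_filter_le_count (k : ℕ) (L : List ℕ) :
    ((Finset.Icc 1 k).filter fun i => k < (L.map simpleRefl).prod i).card ≤ L.count k := by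
  induction L with
  | nil =>
    simp only [List.map_nil, List.prod_nil, Equiv.Perm.one_apply, List.count_nil,
      Nat.le_zero, Finset.card_eq_zero]
    ext i
    simp
  | cons a L ih =>
    simp only [List.map_cons, List.prod_cons, Equiv.Perm.mul_apply]
    generalize (L.map simpleRefl).prod = v at ih ⊢
    by_cases h : a = k
    · subst h
      rw [List.count_cons_self]
      refine le_trans (Finset.card_le_card (t := insert (v.symm a)
        ((Finset.Icc 1 a).filter fun i => a < v i)) ?_)
        ((Finset.card_insert_le _ _).trans (by omega))
      intro i hi
      simp only [Finset.mem_filter, Finset.mem_insert] at hi ⊢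
      by_cases hv : v i = a
      · left
        rw [← hv, Equiv.symm_apply_apply]
      · right
        refine ⟨hi.1, ?_⟩
        have := hi.2
        rw [simpleRefl, Equiv.swap_apply_def] at this
        split_ifs at this <;> omega
    · rw [List.count_cons_of_ne h]
      refine le_trans (Finset.card_le_card ?_) ih
      intro i hi
      simp only [Finset.mem_filter] at hi ⊢
      refine ⟨hi.1, ?_⟩
      have := hi.2
      rw [simpleRefl, Equiv.swap_apply_def] at this
      split_ifs at this <;> omega

/-- Every expression of `w` as a product of simple reflections
(not necessarily reduced) contains at least `expat_k(w)` occurrences of `σ_k`. -/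
theorem expat_le_count_of_word (n : ℕ) (hn : 2 ≤ n) (w : Equiv.Perm ℕ)
    (hw : IsPermOf n w) (k : ℕ) (hk1 : 1 ≤ k) (hk2 : k ≤ n - 1)
    (L : List ℕ) (hL : IsWord n w L) :
    expat n k w ≤ L.count k := by
  obtain ⟨_, rfl⟩ := hL
  refine le_trans ?_ (card_filter_le_count k L)
  unfold expat
  refine le_trans (Finset.card_le_card ?_) (Finset.card_image_le
    (f := fun i => (L.map simpleRefl).prod i))
  intro x hx
  simp only [Finset.mem_inter, Finset.mem_image, Finset.mem_filter, Finset.mem_Icc] at hx ⊢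
  obtain ⟨⟨i, hi, rfl⟩, h2⟩ := hx
  exact ⟨i, ⟨hi, by omega⟩, rfl⟩
end

section
/- Fix n ≥ 2, a permutation w ∈ S_n, and k ∈ {1,…,n−1}. There exists a reduced decomposition of w in which σ_k occurs exactly expat_k(w) times. -/
theorem aux_sr_eq (i x : ℕ) : simpleRefl i x = if x = i then i + 1 else if x = i + 1 then i else x := by
  simp [simpleRefl, Equiv.swap_apply_def]

theorem aux_mem {n : ℕ} {w : Equiv.Perm ℕ} (hw : IsPermOf n w) {x : ℕ} (h1 : 1 ≤ x) (h2 : x ≤ n) :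
    1 ≤ w x ∧ w x ≤ n := by
  by_contra h
  have h3 := hw (w x) (by simpa [Finset.mem_Icc] using h)
  have h4 := w.injective h3
  rw [h4] at h
  exact h ⟨h1, h2⟩

theorem aux_perm {n : ℕ} {w : Equiv.Perm ℕ} (hw : IsPermOf n w) {i : ℕ} (h1 : 1 ≤ i) (h2 : i + 1 ≤ n) :
    IsPermOf n (w * simpleRefl i) := by
  intro x hx
  have h := hw x hx
  simp only [Finset.mem_Icc] at hx
  rw [Equiv.Perm.mul_apply, aux_sr_eq, if_neg (by omega), if_neg (by omega), h]

theorem aux_len {n : ℕ} {w : Equiv.Perm ℕ} {i : ℕ} (h1 : 1 ≤ i) (h2 : i + 1 ≤ n)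
    (hd : w (i + 1) < w i) : len n w = len n (w * simpleRefl i) + 1 := by
  unfold len
  set A := (Finset.Icc 1 n ×ˢ Finset.Icc 1 n).filter fun p : ℕ × ℕ => p.1 < p.2 ∧ w p.2 < w p.1
    with hA
  have hmem : (i, i + 1) ∈ A := by
    simp [hA, hd]; omega
  rw [← Finset.card_erase_add_one hmem]
  congr 1
  have hinv : ∀ x, simpleRefl i (simpleRefl i x) = x := by intro x; simp [simpleRefl]
  refine Finset.card_bij' (fun p _ => (simpleRefl i p.1, simpleRefl i p.2))
    (fun p _ => (simpleRefl i p.1, simpleRefl i p.2)) ?_ ?_ ?_ ?_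
  · rintro ⟨a, b⟩ h
    simp only [hA, Finset.mem_erase, Finset.mem_filter, Finset.mem_product, Finset.mem_Icc,
      ne_eq, Prod.mk.injEq] at h ⊢
    simp only [Equiv.Perm.mul_apply, hinv] at h ⊢
    refine ⟨?_, ?_, h.2.2.2⟩ <;> simp only [aux_sr_eq] <;> split_ifs <;> omega
  · rintro ⟨a, b⟩ h
    simp only [hA, Finset.mem_erase, Finset.mem_filter, Finset.mem_product, Finset.mem_Icc,
      ne_eq, Prod.mk.injEq] at h ⊢
    simp only [Equiv.Perm.mul_apply, hinv] at h ⊢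
    have hab : ¬ (a = i ∧ b = i + 1) := by
      rintro ⟨rfl, rfl⟩
      have := h.2.2
      simp [simpleRefl] at this
      omega
    refine ⟨?_, ?_, ?_, h.2.2⟩
    · have := h.2.1
      simp only [aux_sr_eq]; split_ifs <;> omega
    · simp only [aux_sr_eq]; split_ifs <;> omega
    · simp only [aux_sr_eq]; split_ifs <;> omega
  · rintro ⟨a, b⟩ h; simp [hinv]
  · rintro ⟨a, b⟩ h; simp [hinv]

theorem aux_expat {n k : ℕ} {w : Equiv.Perm ℕ} (hw : IsPermOf n w) (hk : k ≤ n) :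
    expat n k w = ((Finset.Icc 1 k).filter fun i => k < w i).card := by
  unfold expat
  rw [← Finset.card_image_of_injective ((Finset.Icc 1 k).filter fun i => k < w i) w.injective]
  congr 1
  ext y
  simp only [Finset.mem_inter, Finset.mem_image, Finset.mem_Icc, Finset.mem_filter]
  constructor
  · rintro ⟨⟨a, ha, rfl⟩, h⟩
    exact ⟨a, ⟨ha, by omega⟩, rfl⟩
  · rintro ⟨a, ⟨ha, h⟩, rfl⟩
    have := aux_mem hw ha.1 (by omega)
    exact ⟨⟨a, ha, rfl⟩, by omega⟩

theorem aux_expat_ne {n k : ℕ} {w : Equiv.Perm ℕ} (hw : IsPermOf n w) (hk : k ≤ n)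
    {i : ℕ} (h1 : 1 ≤ i) (h2 : i + 1 ≤ n) (hik : i ≠ k) :
    expat n k (w * simpleRefl i) = expat n k w := by
  rw [aux_expat hw hk, aux_expat (aux_perm hw h1 h2) hk]
  have hinv : ∀ x, simpleRefl i (simpleRefl i x) = x := by intro x; simp [simpleRefl]
  refine Finset.card_bij' (fun p _ => simpleRefl i p) (fun p _ => simpleRefl i p) ?_ ?_ ?_ ?_
  · intro a h
    simp only [Finset.mem_filter, Finset.mem_Icc] at h ⊢
    simp only [Equiv.Perm.mul_apply] at h ⊢
    refine ⟨?_, h.2⟩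
    simp only [aux_sr_eq]; split_ifs <;> omega
  · intro a h
    simp only [Finset.mem_filter, Finset.mem_Icc] at h ⊢
    simp only [Equiv.Perm.mul_apply, hinv] at h ⊢
    refine ⟨?_, h.2⟩
    simp only [aux_sr_eq]; split_ifs <;> omega
  · intro a h; simp [hinv]
  · intro a h; simp [hinv]

theorem aux_expat_eq {n k : ℕ} {w : Equiv.Perm ℕ} (hw : IsPermOf n w) (h1 : 1 ≤ k)
    (h2 : k + 1 ≤ n) (ha : k < w k) (hb : w (k + 1) ≤ k) :
    expat n k w = expat n k (w * simpleRefl k) + 1 := by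
  rw [aux_expat hw (by omega), aux_expat (aux_perm hw h1 h2) (by omega)]
  have hmem : k ∈ (Finset.Icc 1 k).filter fun i => k < w i := by simp [ha, h1]
  rw [← Finset.card_erase_add_one hmem]
  congr 2
  ext x
  simp only [Finset.mem_erase, Finset.mem_filter, Finset.mem_Icc]
  simp only [Equiv.Perm.mul_apply]
  by_cases hx : x = k
  · subst hx
    simp [aux_sr_eq, hb]
  · by_cases hx' : x = k + 1
    · subst hx'; simp
    · simp [aux_sr_eq, hx, hx']

theorem aux_id {n : ℕ} {w : Equiv.Perm ℕ} (hw : IsPermOf n w)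
    (h : ∀ i, 1 ≤ i → i + 1 ≤ n → w i < w (i + 1)) : w = 1 := by
  have hm : StrictMono w := by
    apply strictMono_nat_of_lt_succ
    intro x
    rcases Nat.eq_zero_or_pos x with rfl | hx
    · have h0 : w 0 = 0 := hw 0 (by simp)
      have : w (0 + 1) ≠ w 0 := fun e => by simpa using w.injective e
      omega
    · by_cases hx2 : x + 1 ≤ n
      · exact h x hx hx2
      · have e1 : w (x + 1) = x + 1 := hw _ (by simp [Finset.mem_Icc]; omega)
        by_cases hx3 : x ≤ n
        · have := aux_mem hw hx hx3
          omega
        · have e2 : w x = x := hw _ (by simp [Finset.mem_Icc]; omega)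
          omega
  let e : ℕ ≃o ℕ := ⟨w, fun {a b} => hm.le_iff_le⟩
  have he : e = OrderIso.refl ℕ := Subsingleton.elim _ _
  ext x
  exact congrArg (fun f : ℕ ≃o ℕ => f x) he

theorem aux_block {n k : ℕ} {w : Equiv.Perm ℕ} (hw : IsPermOf n w)
    (h1 : 1 ≤ k) (h2 : k + 1 ≤ n)
    (h : ∀ i, 1 ≤ i → i + 1 ≤ n → i ≠ k → w i < w (i + 1)) (hd : w (k + 1) < w k) :
    k < w k ∧ w (k + 1) ≤ k := by
  have h0 : w 0 = 0 := hw 0 (by simp)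
  have hN : w (n + 1) = n + 1 := hw _ (by simp)
  have hup : ∀ d a, (k < a ∨ a + d ≤ k) → a + d ≤ n + 1 → w a + d ≤ w (a + d) := by
    intro d
    induction d with
    | zero => intro a _ _; simp
    | succ d ih =>
      intro a h3 h4
      have i1 := ih a (by omega) (by omega)
      have : w (a + d) < w (a + d + 1) := by
        by_cases hz : a + d = 0
        · have : w (0 + 1) ≠ w 0 := fun e => by simpa using w.injective e
          rw [hz]; omega
        · by_cases hn : a + d + 1 ≤ n
          · exact h _ (by omega) hn (by omega)
          · have := aux_mem hw (x := a + d) (by omega) (by omega)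
            have e : a + d + 1 = n + 1 := by omega
            rw [e]; omega
      rw [← Nat.add_assoc a d 1]
      omega
  constructor
  · by_contra hc
    have hfix : ∀ x ≤ k, w x = x := by
      intro x hx
      have p1 := hup x 0 (by omega) (by omega)
      have p2 := hup (k - x) x (by omega) (by omega)
      rw [Nat.add_sub_cancel' hx] at p2
      rw [Nat.zero_add] at p1
      omega
    have := w.injective (hfix (w (k + 1)) (by omega))
    omega
  · by_contra hc
    have hfix : ∀ x, k + 1 ≤ x → x ≤ n → w x = x := by
      intro x hx hxn
      have p1 := hup (x - (k + 1)) (k + 1) (by omega) (by omega)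
      have p2 := hup (n + 1 - x) x (by omega) (by omega)
      rw [Nat.add_sub_cancel' hx] at p1
      rw [Nat.add_sub_cancel' (by omega)] at p2
      omega
    have := aux_mem hw h1 (by omega)
    have := w.injective (hfix (w k) (by omega) (by omega))
    omega

theorem aux_snoc {n : ℕ} {w : Equiv.Perm ℕ} {i : ℕ} (h1 : 1 ≤ i) (h2 : i + 1 ≤ n)
    (hd : w (i + 1) < w i) {L : List ℕ} (hL : IsReducedWord n (w * simpleRefl i) L) :
    IsReducedWord n w (L ++ [i]) := by
  obtain ⟨⟨ha, hb⟩, hc⟩ := hL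
  refine ⟨⟨?_, ?_⟩, ?_⟩
  · intro j hj
    rcases List.mem_append.1 hj with hj | hj
    · exact ha j hj
    · have : j = i := by simpa using hj
      omega
  · rw [List.map_append, List.prod_append, hb]
    simp [mul_assoc, simpleRefl]
  · rw [aux_len h1 h2 hd, ← hc]; simp

/-- There is a reduced decomposition of `w` in which `σ_k` occurs
exactly `expat_k(w)` times. -/
theorem exists_reduced_word_count_eq_expat (n : ℕ) (hn : 2 ≤ n) (w : Equiv.Perm ℕ)
    (hw : IsPermOf n w) (k : ℕ) (hk1 : 1 ≤ k) (hk2 : k ≤ n - 1) :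
    ∃ L : List ℕ, IsReducedWord n w L ∧ L.count k = expat n k w := by
  induction hN : len n w using Nat.strong_induction_on generalizing w with
  | _ N ih =>
  subst hN
  by_cases hex : ∃ i, 1 ≤ i ∧ i + 1 ≤ n ∧ i ≠ k ∧ w (i + 1) < w i
  · obtain ⟨i, h1, h2, hik, hd⟩ := hex
    obtain ⟨L, hL, hc⟩ := ih _ (by rw [aux_len h1 h2 hd]; omega) _ (aux_perm hw h1 h2) rfl
    refine ⟨L ++ [i], aux_snoc h1 h2 hd hL, ?_⟩
    rw [aux_expat_ne hw (by omega) h1 h2 hik] at hc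
    simp [List.count_append, hc, hik]
  · have hasc : ∀ i, 1 ≤ i → i + 1 ≤ n → i ≠ k → w i < w (i + 1) := by
      intro i h1 h2 hik
      by_contra hcon
      have : w (i + 1) ≠ w i := fun e => by simpa using w.injective e
      exact hex ⟨i, h1, h2, hik, by omega⟩
    by_cases hd : w (k + 1) < w k
    · have h2 : k + 1 ≤ n := by omega
      obtain ⟨ha, hb⟩ := aux_block hw hk1 h2 hasc hd
      obtain ⟨L, hL, hc⟩ := ih _ (by rw [aux_len hk1 h2 hd]; omega) _ (aux_perm hw hk1 h2) rfl
      refine ⟨L ++ [k], aux_snoc hk1 h2 hd hL, ?_⟩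
      rw [aux_expat_eq hw hk1 h2 ha hb, ← hc]
      simp [List.count_append]
    · have hw1 : w = 1 := by
        apply aux_id hw
        intro i h1 h2
        by_cases hik : i = k
        · subst hik
          have : w (i + 1) ≠ w i := fun e => by simpa using w.injective e
          omega
        · exact hasc i h1 h2 hik
      subst hw1
      refine ⟨[], ⟨⟨by simp, by simp⟩, ?_⟩, ?_⟩
      · symm
        unfold len
        rw [List.length_nil, Finset.card_eq_zero, Finset.filter_eq_empty_iff]
        rintro ⟨a, b⟩ _
        simp only [Equiv.Perm.one_apply]
        omega
      · symm
        rw [aux_expat hw (by omega), List.count_nil, Finset.card_eq_zero,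
          Finset.filter_eq_empty_iff]
        intro x hx
        simp only [Finset.mem_Icc] at hx
        simp only [Equiv.Perm.one_apply]
        omega
end

section
/- Fix n ≥ 2, w ∈ S_n, and k ∈ {1,…,n−1}. If max_k(w) = 1, then w has no 3412-pattern straddling k in position, no 3412-pattern straddling k in value, and no 321-pattern straddling k in both position and value. -/
theorem sr_apply (j x : ℕ) : simpleRefl j x = if x = j then j + 1 else if x = j + 1 then j else x := by
  simp [simpleRefl, Equiv.swap_apply_def]

theorem sr_sq (j : ℕ) : simpleRefl j * simpleRefl j = 1 := by
  simp [simpleRefl]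

theorem len_descent (n : ℕ) (w : Equiv.Perm ℕ) (j : ℕ) (h1 : 1 ≤ j) (h2 : j ≤ n - 1)
    (hd : w (j + 1) < w j) : len n w = len n (w * simpleRefl j) + 1 := by
  unfold len
  have hmem : (j, j + 1) ∈ (Finset.Icc 1 n ×ˢ Finset.Icc 1 n).filter
      fun p => p.1 < p.2 ∧ w p.2 < w p.1 := by
    simp; omega
  rw [← Finset.card_erase_add_one hmem]
  congr 1
  apply Finset.card_nbij' (fun p => (simpleRefl j p.1, simpleRefl j p.2))
    (fun p => (simpleRefl j p.1, simpleRefl j p.2))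
  · rintro ⟨a, b⟩ h
    simp only [Finset.coe_erase, Finset.coe_filter, Finset.mem_product, Finset.mem_Icc,
      Set.mem_sdiff, Set.mem_ofPred_eq, Set.mem_singleton_iff, Prod.mk.injEq, Equiv.Perm.mul_apply,
      sr_apply] at h ⊢
    grind
  · rintro ⟨a, b⟩ h
    simp only [Finset.coe_erase, Finset.coe_filter, Finset.mem_product, Finset.mem_Icc,
      Set.mem_sdiff, Set.mem_ofPred_eq, Set.mem_singleton_iff, Prod.mk.injEq, Equiv.Perm.mul_apply,
      sr_apply] at h ⊢
    grind
  · rintro ⟨a, b⟩ h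
    simp [simpleRefl]
  · rintro ⟨a, b⟩ h
    simp [simpleRefl]

theorem perm_descent (n : ℕ) (w : Equiv.Perm ℕ) (hw : IsPermOf n w) (j : ℕ) (h1 : 1 ≤ j)
    (h2 : j ≤ n - 1) : IsPermOf n (w * simpleRefl j) := by
  intro x hx
  have := hw x hx
  simp only [Finset.mem_Icc, Equiv.Perm.mul_apply, sr_apply] at hx ⊢
  grind

theorem red_append (n : ℕ) (w : Equiv.Perm ℕ) (j : ℕ) (h1 : 1 ≤ j) (h2 : j ≤ n - 1)
    (hd : w (j + 1) < w j) (L : List ℕ) (hL : IsReducedWord n (w * simpleRefl j) L) :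
    IsReducedWord n w (L ++ [j]) := by
  obtain ⟨⟨ha, hb⟩, hc⟩ := hL
  refine ⟨⟨?_, ?_⟩, ?_⟩
  · intro i hi
    simp at hi
    rcases hi with hi | rfl
    · exact ha i hi
    · exact ⟨h1, h2⟩
  · simp [hb, mul_assoc, sr_sq]
  · rw [len_descent n w j h1 h2 hd]; simp [hc]

theorem exists_desc (w : Equiv.Perm ℕ) (a b : ℕ) (hab : a < b) (h : w b < w a) :
    ∃ j, a ≤ j ∧ j < b ∧ w (j + 1) < w j := by
  by_contra! hc
  have : ∀ m, a ≤ m → m ≤ b → w a ≤ w m := by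
    intro m hm
    induction m, hm using Nat.le_induction with
    | base => intro _; exact le_rfl
    | succ m hm ih => intro hmb; exact (ih (by omega)).trans (hc m hm (by omega))
  have := this b hab.le le_rfl
  omega

theorem eq_one_of_no_desc (n : ℕ) (w : Equiv.Perm ℕ) (hw : IsPermOf n w)
    (h : ∀ j, 1 ≤ j → j ≤ n - 1 → ¬ w (j + 1) < w j) : w = 1 := by
  have hout : ∀ x, x < 1 ∨ n < x → w x = x := by
    intro x hx; apply hw; simp; omega
  have hle : ∀ x, x ≤ n → w x ≤ n := by
    intro x hx
    by_contra hc
    have := w.injective (hout (w x) (by omega))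
    omega
  have hmono : StrictMono w := by
    apply strictMono_nat_of_lt_succ
    intro j
    have hne : w j ≠ w (j + 1) := fun e => by have := w.injective e; omega
    by_cases h0 : j = 0
    · subst h0
      have := hout 0 (by omega)
      omega
    by_cases h1 : j ≤ n - 1
    · have := h j (by omega) h1
      omega
    · have e := hout (j + 1) (by omega)
      by_cases h2 : j ≤ n
      · have := hle j h2; omega
      · have := hout j (by omega); omega
  ext x
  have h1 := hmono.le_apply (x := x)
  have hm2 : StrictMono (w⁻¹ : Equiv.Perm ℕ) := by
    intro a b hab
    rw [← hmono.lt_iff_lt]; simpa using hab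
  have h2 := hm2.le_apply (x := w x)
  simp at h2 ⊢
  omega

theorem exists_red (n : ℕ) : ∀ m (w : Equiv.Perm ℕ), IsPermOf n w → len n w = m →
    ∃ L, IsReducedWord n w L := by
  intro m
  induction m with
  | zero =>
    intro w hw hl
    have : w = 1 := by
      apply eq_one_of_no_desc n w hw
      intro j h1 h2 hd
      have := len_descent n w j h1 h2 hd
      omega
    refine ⟨[], ⟨by simp, by simp [this]⟩, by simp [hl]⟩
  | succ m ih =>
    intro w hw hl
    by_cases h : ∃ j, 1 ≤ j ∧ j ≤ n - 1 ∧ w (j + 1) < w j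
    · obtain ⟨j, h1, h2, hd⟩ := h
      have := len_descent n w j h1 h2 hd
      obtain ⟨L, hL⟩ := ih _ (perm_descent n w hw j h1 h2) (by omega)
      exact ⟨_, red_append n w j h1 h2 hd L hL⟩
    · exfalso
      have : w = 1 := by
        apply eq_one_of_no_desc n w hw
        intro j h1 h2 hd
        exact h ⟨j, h1, h2, hd⟩
      subst this
      unfold len at hl
      rw [Finset.card_eq_zero.2] at hl
      · omega
      · apply Finset.filter_eq_empty_iff.2
        rintro ⟨a, b⟩ _
        simp
        omega

theorem count_up (k : ℕ) : ∀ (L : List ℕ) (S : Finset ℕ),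
    (∀ i ∈ S, i ≤ k ∧ k < (L.map simpleRefl).prod i) → S.card ≤ L.count k := by
  intro L
  induction L with
  | nil =>
    intro S hS
    have : S = ∅ := by
      apply Finset.eq_empty_of_forall_notMem
      intro i hi
      have := hS i hi
      simp at this
      omega
    simp [this]
  | cons j L ih =>
    intro S hS
    simp only [List.map_cons, List.prod_cons, Equiv.Perm.mul_apply, sr_apply] at hS
    set u := (L.map simpleRefl).prod with hu
    by_cases hj : j = k
    · subst hj
      have := ih (S.erase (u⁻¹ j)) (by
        intro i hi
        rw [Finset.mem_erase] at hi
        have h1 := hS i hi.2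
        have h2 : u i ≠ j := fun e => hi.1 (by rw [← e]; simp)
        grind)
      have h2 := Finset.pred_card_le_card_erase (s := S) (a := u⁻¹ j)
      simp
      omega
    · have := ih S (by intro i hi; have h1 := hS i hi; grind)
      rw [List.count_cons_of_ne hj]
      exact this

theorem count_down (k : ℕ) : ∀ (L : List ℕ) (S : Finset ℕ),
    (∀ i ∈ S, k < i ∧ (L.map simpleRefl).prod i ≤ k) → S.card ≤ L.count k := by
  intro L
  induction L with
  | nil =>
    intro S hS
    have : S = ∅ := by
      apply Finset.eq_empty_of_forall_notMem
      intro i hi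
      have := hS i hi
      simp at this
      omega
    simp [this]
  | cons j L ih =>
    intro S hS
    simp only [List.map_cons, List.prod_cons, Equiv.Perm.mul_apply, sr_apply] at hS
    set u := (L.map simpleRefl).prod with hu
    by_cases hj : j = k
    · subst hj
      have := ih (S.erase (u⁻¹ (j + 1))) (by
        intro i hi
        rw [Finset.mem_erase] at hi
        have h1 := hS i hi.2
        have h2 : u i ≠ j + 1 := fun e => hi.1 (by rw [← e]; simp)
        grind)
      have h2 := Finset.pred_card_le_card_erase (s := S) (a := u⁻¹ (j + 1))
      simp
      omega
    · have := ih S (by intro i hi; have h1 := hS i hi; grind)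
      rw [List.count_cons_of_ne hj]
      exact this

theorem red_321 (n k : ℕ) : ∀ m (w : Equiv.Perm ℕ), IsPermOf n w → len n w = m →
    ∀ i1 i2 i3, Is321At n w i1 i2 i3 → i1 ≤ k → k < i3 → w i3 ≤ k → k < w i1 →
    ∃ L, IsReducedWord n w L ∧ 2 ≤ L.count k := by
  intro m
  induction m with
  | zero =>
    intro w hw hl i1 i2 i3 h _ _ _ _
    obtain ⟨ha, hb, hc, hd, he, hf⟩ := h
    obtain ⟨j, h1, h2, h3⟩ := exists_desc w i2 i3 hc he
    have := len_descent n w j (by omega) (by omega) h3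
    omega
  | succ m ih =>
    intro w hw hl i1 i2 i3 h hp1 hp3 hv3 hv1
    obtain ⟨ha, hb, hc, hd, he, hf⟩ := h
    have key : ∃ j, 1 ≤ j ∧ j ≤ n - 1 ∧ w (j + 1) < w j ∧
        ((i2 ≤ k ∧ i2 ≤ j ∧ j < i3) ∨ (k < i2 ∧ i1 ≤ j ∧ j < i2)) := by
      by_cases hk : i2 ≤ k
      · obtain ⟨j, h1, h2, h3⟩ := exists_desc w i2 i3 hc he
        exact ⟨j, by omega, by omega, h3, Or.inl ⟨hk, h1, h2⟩⟩
      · obtain ⟨j, h1, h2, h3⟩ := exists_desc w i1 i2 hb hf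
        exact ⟨j, by omega, by omega, h3, Or.inr ⟨by omega, h1, h2⟩⟩
    obtain ⟨j, h1, h2, hdj, hcase⟩ := key
    have hlen := len_descent n w j h1 h2 hdj
    have hw' := perm_descent n w hw j h1 h2
    by_cases hjk : j = k
    · subst hjk
      obtain ⟨L, hL⟩ := exists_red n m _ hw' (by omega)
      refine ⟨_, red_append n w j h1 h2 hdj L hL, ?_⟩
      have hpos : 1 ≤ L.count j := by
        rcases hcase with hcase | hcase
        · have := count_up j L {i1} (by
            intro i hi
            rw [Finset.mem_singleton] at hi
            subst hi
            rw [hL.1.2, Equiv.Perm.mul_apply, sr_apply, if_neg (by omega), if_neg (by omega)]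
            omega)
          simpa using this
        · have := count_down j L {i3} (by
            intro i hi
            rw [Finset.mem_singleton] at hi
            subst hi
            rw [hL.1.2, Equiv.Perm.mul_apply, sr_apply, if_neg (by omega), if_neg (by omega)]
            omega)
          simpa using this
      rw [List.count_append, List.count_singleton_self]
      omega
    · have hs : ∀ x, (w * simpleRefl j) (simpleRefl j x) = w x := by
        intro x; simp [simpleRefl]
      obtain ⟨L, hL, hc2⟩ := ih (w * simpleRefl j) hw' (by omega)
        (simpleRefl j i1) (simpleRefl j i2) (simpleRefl j i3)
        (by
          unfold Is321At
          simp only [hs]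
          refine ⟨?_, ?_, ?_, ?_, he, hf⟩ <;> simp only [sr_apply] <;> grind)
        (by simp only [sr_apply]; grind) (by simp only [sr_apply]; grind)
        (by rw [hs]; exact hv3) (by rw [hs]; exact hv1)
      exact ⟨_, red_append n w j h1 h2 hdj L hL, by
        rw [List.count_append]; omega⟩

/-- Lemma: `max_k(w) = 1`. If `max_k(w) = 1`, then `w` has no
`3412`-pattern straddling `k` in position, no `3412`-pattern straddling `k` in value,
and no `321`-pattern straddling `k` in both position and value. -/
theorem no_straddling_of_maxOcc_eq_one (n : ℕ) (hn : 2 ≤ n) (w : Equiv.Perm ℕ)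
    (hw : IsPermOf n w) (k : ℕ) (hk1 : 1 ≤ k) (hk2 : k ≤ n - 1)
    (hmax : maxOcc n k w = 1) :
    (¬ ∃ i1 i2 i3 i4, Is3412At n w i1 i2 i3 i4 ∧ i2 ≤ k ∧ k < i3) ∧
    (¬ ∃ i1 i2 i3 i4, Is3412At n w i1 i2 i3 i4 ∧ w i4 ≤ k ∧ k < w i1) ∧
    (¬ ∃ i1 i2 i3, Is321At n w i1 i2 i3 ∧ i1 ≤ k ∧ k < i3 ∧ w i3 ≤ k ∧ k < w i1) := by
  have hle : ∀ L, IsReducedWord n w L → L.count k ≤ 1 := by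
    intro L hL
    rw [← hmax]
    apply le_csSup
    · refine ⟨len n w, ?_⟩
      rintro m ⟨L', hL', rfl⟩
      rw [← hL'.2]
      exact List.count_le_length
    · exact ⟨L, hL, rfl⟩
  obtain ⟨L, hL⟩ := exists_red n _ w hw rfl
  have hL1 := hle L hL
  have up : ∀ a b, a < b → b ≤ k → k < w a → k < w b → False := by
    intro a b hab hb h1 h2
    have := count_up k L {a, b} (by
      rw [hL.1.2]
      intro i hi
      simp at hi
      rcases hi with rfl | rfl <;> omega)
    rw [Finset.card_pair (by omega)] at this
    omega
  have down : ∀ a b, a < b → k < a → w a ≤ k → w b ≤ k → False := by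
    intro a b hab hb h1 h2
    have := count_down k L {a, b} (by
      rw [hL.1.2]
      intro i hi
      simp at hi
      rcases hi with rfl | rfl <;> omega)
    rw [Finset.card_pair (by omega)] at this
    omega
  refine ⟨?_, ?_, ?_⟩
  · rintro ⟨i1, i2, i3, i4, ⟨_, h12, h23, h34, _, a, b, c⟩, p, q⟩
    by_cases h : w i4 ≤ k
    · exact down i3 i4 h34 q (by omega) h
    · exact up i1 i2 h12 p (by omega) (by omega)
  · rintro ⟨i1, i2, i3, i4, ⟨_, h12, h23, h34, _, a, b, c⟩, p, q⟩
    by_cases h : i2 ≤ k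
    · exact up i1 i2 h12 h q (by omega)
    · exact down i3 i4 h34 (by omega) (by omega) p
  · rintro ⟨i1, i2, i3, h, h1, h2, h3, h4⟩
    obtain ⟨L', hL', hc⟩ := red_321 n k _ w hw rfl i1 i2 i3 h h1 h2 h3 h4
    have := hle L' hL'
    omega
end

section
/- Fix n ≥ 2, v ∈ S_n, k ∈ {1,…,n−1}, and h ∈ {1,…,n−1} with h ≠ k. If ℓ(vσ_h) = ℓ(v) + 1, then PosPair_k(vσ_h) ≥ PosPair_k(v); indeed, the map (x,y) ↦ (σ_h(x), σ_h(y)) sends each position pair at k of v to a position pair at k of vσ_h, injectively. -/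
theorem aux_lt (h x y : ℕ) (hxy : x < y) (hn : ¬ (x = h ∧ y = h + 1)) :
    simpleRefl h x < simpleRefl h y := by
  unfold simpleRefl
  simp only [Equiv.swap_apply_def]
  split_ifs <;> omega

theorem aux_ge (h x : ℕ) (hh : 1 ≤ h) (hx : 1 ≤ x) : 1 ≤ simpleRefl h x := by
  unfold simpleRefl
  simp only [Equiv.swap_apply_def]
  split_ifs <;> omega

theorem aux_le (h m x : ℕ) (hh : h ≠ m) (hx : x ≤ m) : simpleRefl h x ≤ m := by
  unfold simpleRefl
  simp only [Equiv.swap_apply_def]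
  split_ifs <;> omega

theorem aux_gt (h m x : ℕ) (hh : h ≠ m) (hx : m < x) : m < simpleRefl h x := by
  unfold simpleRefl
  simp only [Equiv.swap_apply_def]
  split_ifs <;> omega

theorem aux_invol (h x : ℕ) : simpleRefl h (simpleRefl h x) = x := by
  simp [simpleRefl]

theorem aux_mul (v : Equiv.Perm ℕ) (h x : ℕ) :
    (v * simpleRefl h) (simpleRefl h x) = v x := by
  rw [Equiv.Perm.mul_apply, aux_invol]

theorem aux_asc (n : ℕ) (v : Equiv.Perm ℕ) (h : ℕ) (hh1 : 1 ≤ h) (hh2 : h < n)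
    (hlen : len n (v * simpleRefl h) = len n v + 1) : v h < v (h + 1) := by
  by_contra hc
  have hle : len n (v * simpleRefl h) ≤ len n v := by
    unfold len
    apply Finset.card_le_card_of_injOn
      (fun p : ℕ × ℕ => (simpleRefl h p.1, simpleRefl h p.2))
    · rintro ⟨x, y⟩ hp
      replace hp := Finset.mem_filter.1 (Finset.mem_coe.1 hp)
      refine Finset.mem_coe.2 (Finset.mem_filter.2 ?_)
      simp only [Finset.mem_product, Finset.mem_Icc,
        Equiv.Perm.mul_apply] at hp ⊢
      obtain ⟨⟨⟨a, b⟩, c, d⟩, e, f⟩ := hp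
      refine ⟨⟨⟨aux_ge h x hh1 a, aux_le h n x (by omega) b⟩, aux_ge h y hh1 c,
        aux_le h n y (by omega) d⟩, aux_lt h x y e ?_, f⟩
      rintro ⟨rfl, rfl⟩
      simp [simpleRefl] at f
      omega
    · rintro ⟨x, y⟩ _ ⟨x', y'⟩ _ he
      simpa using he
  omega

theorem aux_map (n : ℕ) (v : Equiv.Perm ℕ) (k h : ℕ)
    (hh1 : 1 ≤ h) (hh2 : h < n) (hne : h ≠ k) (hasc : v h < v (h + 1))
    (p : ℕ × ℕ) (hp : IsPosPair n k v p) :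
    IsPosPair n k (v * simpleRefl h) (simpleRefl h p.1, simpleRefl h p.2) := by
  obtain ⟨a, b⟩ := p
  have key : ∀ x y, x < y → v y < v x → simpleRefl h x < simpleRefl h y := by
    intro x y hxy hv
    apply aux_lt h x y hxy
    rintro ⟨rfl, rfl⟩
    omega
  have hle := fun x hx => aux_le h n x (by omega) hx
  rcases hp with ⟨i2, ⟨h1, h2, h3, h4, h5, h6⟩, h7, h8⟩ |
    ⟨i1, i4, ⟨h1, h2, h3, h4, h5, h6, h7, h8⟩, h9, h10⟩
  · dsimp only at *
    refine Or.inl ⟨simpleRefl h i2, ⟨aux_ge h a hh1 h1, key _ _ h2 h6, key _ _ h3 h5,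
      hle _ h4, ?_, ?_⟩, aux_le h k a hne h7, aux_gt h k b hne h8⟩
    · simpa only [aux_mul] using h5
    · simpa only [aux_mul] using h6
  · dsimp only at *
    have hab := key a b h3 (by omega)
    by_cases c1 : i1 = h ∧ a = h + 1
    · refine Or.inl ⟨simpleRefl h i1, ⟨aux_ge h a hh1 (by omega), ?_,
        key _ _ (by omega) (by omega), hle _ (by omega), ?_, ?_⟩,
        aux_le h k a hne h9, aux_gt h k b hne h10⟩
      · obtain ⟨rfl, rfl⟩ := c1
        simp [simpleRefl]
      · simp only [aux_mul]; omega
      · simp only [aux_mul]; omega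
    by_cases c2 : b = h ∧ i4 = h + 1
    · refine Or.inl ⟨simpleRefl h i4, ⟨aux_ge h a hh1 (by omega),
        key _ _ (by omega) (by omega), ?_, hle _ (by omega), ?_, ?_⟩,
        aux_le h k a hne h9, aux_gt h k b hne h10⟩
      · obtain ⟨rfl, rfl⟩ := c2
        simp [simpleRefl]
      · simp only [aux_mul]; omega
      · simp only [aux_mul]; omega
    refine Or.inr ⟨simpleRefl h i1, simpleRefl h i4, ⟨aux_ge h i1 hh1 h1,
      aux_lt h _ _ h2 c1, hab, aux_lt h _ _ h4 c2, hle _ h5, ?_, ?_, ?_⟩,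
      aux_le h k a hne h9, aux_gt h k b hne h10⟩ <;> simpa only [aux_mul]

/-- If `h ≠ k` and `ℓ(vσ_h) = ℓ(v) + 1`, then
`(x,y) ↦ (σ_h(x), σ_h(y))` sends position pairs at `k` of `v` to position pairs at `k`
of `vσ_h`, injectively; in particular `PosPair_k(vσ_h) ≥ PosPair_k(v)`. -/
theorem posPair_persists_mul_other (n : ℕ) (hn : 2 ≤ n) (v : Equiv.Perm ℕ)
    (hv : IsPermOf n v) (k h : ℕ) (hk1 : 1 ≤ k) (hk2 : k ≤ n - 1)
    (hh1 : 1 ≤ h) (hh2 : h ≤ n - 1) (hne : h ≠ k)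
    (hlen : len n (v * simpleRefl h) = len n v + 1) :
    (∀ p : ℕ × ℕ, IsPosPair n k v p →
        IsPosPair n k (v * simpleRefl h) (simpleRefl h p.1, simpleRefl h p.2)) ∧
    Set.InjOn (fun p : ℕ × ℕ => (simpleRefl h p.1, simpleRefl h p.2))
        {p : ℕ × ℕ | IsPosPair n k v p} ∧
    posPairCount n k v ≤ posPairCount n k (v * simpleRefl h) := by
  have hh3 : h < n := by omega
  have hasc := aux_asc n v h hh1 hh3 hlen
  have hmap := aux_map n v k h hh1 hh3 hne hasc
  have hinj : Set.InjOn (fun p : ℕ × ℕ => (simpleRefl h p.1, simpleRefl h p.2))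
        {p : ℕ × ℕ | IsPosPair n k v p} := by
    rintro ⟨x, y⟩ _ ⟨x', y'⟩ _ he
    simpa using he
  refine ⟨hmap, hinj, ?_⟩
  unfold posPairCount
  refine Set.ncard_le_ncard_of_injOn _ hmap hinj ?_
  apply Set.Finite.subset (Finset.finite_toSet (Finset.Icc 0 n ×ˢ Finset.Icc 0 n))
  rintro ⟨a, b⟩ hp
  simp only [Finset.coe_product, Finset.coe_Icc, Set.mem_prod, Set.mem_Icc]
  rcases hp with ⟨i2, ⟨h1, h2, h3, h4, h5, h6⟩, h7, h8⟩ |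
    ⟨i1, i4, ⟨h1, h2, h3, h4, h5, h6, h7, h8⟩, h9, h10⟩ <;> dsimp only at * <;> omega
end
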